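/- arXiv:1404.7497 — 4 statements merged into one kernel-verified Lean document; each statement's English description precedes it below -/
import Mathlib

section
/- Let G be a finite group with neutral element e, and let A = ⊕_{g∈G} ℂ·e_g be the G-graded complex vector space with one-dimensional homogeneous components. Consider the set of separable Frobenius algebra structures (μ, η, Δ, ε) on A (i.e. μ is associative with unit η, Δ is coassociative with counit ε, the Frobenius law (μ⊗id)∘(id⊗Δ) = Δ∘μ = (id⊗μ)∘(Δ⊗id) holds, and μ∘Δ = id) such that: μ(e_g ⊗ e_h) is a nonzero scalar multiple of e_{gh} for all g,h ∈ G; η(1) = e_e; Δ(e_k) lies in ⊕_{(g,h): gh=k} ℂ·(e_g ⊗ e_h) for every k ∈ G; and ε(e_g) = 0 for all g ≠ e. Call two such structures equivalent if there is an isomorphism of Frobenius algebras between them of the form e_g ↦ α(g)·e_g for some function α : G → ℂˣ. Then the assignment sending a normalized 2-cocycle c to the structure with μ(e_g ⊗ e_h) = c(g,h)·e_{gh}, η(1) = e_e, Δ(e_k) = |G|⁻¹ Σ_{(g,h): gh=k} c(g,h)⁻¹ e_g ⊗ e_h, and ε(e_g) = |G|·δ_{g,e}, induces a well-defined bijection from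 the second group cohomology H²(G, ℂˣ) (with trivial G-action on ℂˣ) to the set of equivalence classes of such separable Frobenius structures on A. -/
/-! STATEMENT 0: Separable Frobenius structures on `A = ⊕_{g ∈ G} ℂ·e_g` compatible with
the `G`-grading are classified, up to rescaling isomorphisms `e_g ↦ α(g)·e_g`, by the
second group cohomology `H²(G, ℂˣ)` (with trivial action); the bijection is induced by
`c ↦ (μ_c, η, Δ_c, ε)` with `μ_c(e_g ⊗ e_h) = c(g,h)·e_{gh}`, `η(1) = e_e`,
`Δ_c(e_k) = |G|⁻¹ Σ_{gh=k} c(g,h)⁻¹ e_g ⊗ e_h`, `ε(e_g) = |G|·δ_{g,e}`. -/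

open Finsupp TensorProduct

/-- The data of a (candidate) Frobenius algebra structure `(μ, η, Δ, ε)` on the
`G`-graded vector space `⊕_{g ∈ G} ℂ·e_g = (G →₀ ℂ)`. -/
structure FrobeniusData (G : Type*) [Group G] where
  mul : (G →₀ ℂ) →ₗ[ℂ] (G →₀ ℂ) →ₗ[ℂ] (G →₀ ℂ)
  unit : ℂ →ₗ[ℂ] (G →₀ ℂ)
  comul : (G →₀ ℂ) →ₗ[ℂ] TensorProduct ℂ (G →₀ ℂ) (G →₀ ℂ)
  counit : (G →₀ ℂ) →ₗ[ℂ] ℂ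

variable {G : Type*} [Group G]

/-- The predicate that `(μ, η, Δ, ε)` is a separable Frobenius algebra structure on
`⊕_{g ∈ G} ℂ·e_g` such that `μ(e_g ⊗ e_h)` is a nonzero multiple of `e_{gh}`,
`η(1) = e_e`, `Δ(e_k)` lies in `⊕_{gh=k} ℂ·(e_g ⊗ e_h)`, and `ε(e_g) = 0` for
`g ≠ e`. -/
def FrobeniusData.IsSepFrob (F : FrobeniusData G) : Prop :=
  -- associativity and unitality of μ
  (∀ x y z : G →₀ ℂ, F.mul (F.mul x y) z = F.mul x (F.mul y z)) ∧
  (∀ x : G →₀ ℂ, F.mul (F.unit 1) x = x) ∧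
  (∀ x : G →₀ ℂ, F.mul x (F.unit 1) = x) ∧
  -- coassociativity and counitality of Δ
  ((TensorProduct.assoc ℂ (G →₀ ℂ) (G →₀ ℂ) (G →₀ ℂ)).toLinearMap
      ∘ₗ TensorProduct.map F.comul LinearMap.id ∘ₗ F.comul
    = TensorProduct.map LinearMap.id F.comul ∘ₗ F.comul) ∧
  ((TensorProduct.lid ℂ (G →₀ ℂ)).toLinearMap
      ∘ₗ TensorProduct.map F.counit LinearMap.id ∘ₗ F.comul = LinearMap.id) ∧
  ((TensorProduct.rid ℂ (G →₀ ℂ)).toLinearMap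
      ∘ₗ TensorProduct.map LinearMap.id F.counit ∘ₗ F.comul = LinearMap.id) ∧
  -- the Frobenius law
  (TensorProduct.map (TensorProduct.lift F.mul) LinearMap.id
      ∘ₗ (TensorProduct.assoc ℂ (G →₀ ℂ) (G →₀ ℂ) (G →₀ ℂ)).symm.toLinearMap
      ∘ₗ TensorProduct.map LinearMap.id F.comul
    = F.comul ∘ₗ TensorProduct.lift F.mul) ∧
  (TensorProduct.map LinearMap.id (TensorProduct.lift F.mul)
      ∘ₗ (TensorProduct.assoc ℂ (G →₀ ℂ) (G →₀ ℂ) (G →₀ ℂ)).toLinearMap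
      ∘ₗ TensorProduct.map F.comul LinearMap.id
    = F.comul ∘ₗ TensorProduct.lift F.mul) ∧
  -- separability
  (TensorProduct.lift F.mul ∘ₗ F.comul = LinearMap.id) ∧
  -- compatibility with the G-grading
  (∀ g h : G, ∃ z : ℂˣ,
    F.mul (Finsupp.single g 1) (Finsupp.single h 1) = (z : ℂ) • Finsupp.single (g * h) 1) ∧
  (F.unit 1 = Finsupp.single 1 1) ∧
  (∀ k : G, F.comul (Finsupp.single k 1) ∈ Submodule.span ℂ
    {v : TensorProduct ℂ (G →₀ ℂ) (G →₀ ℂ) | ∃ g h : G, g * h = k ∧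
      v = Finsupp.single g (1 : ℂ) ⊗ₜ[ℂ] Finsupp.single h (1 : ℂ)}) ∧
  (∀ g : G, g ≠ 1 → F.counit (Finsupp.single g 1) = 0)

/-- The separable Frobenius structures on `⊕_{g ∈ G} ℂ·e_g` under consideration. -/
def SepFrobStruct (G : Type*) [Group G] : Type _ :=
  {F : FrobeniusData G // F.IsSepFrob}

/-- The rescaling map `e_g ↦ α(g)·e_g` on `⊕_{g ∈ G} ℂ·e_g`. -/
noncomputable def rescale (α : G → ℂˣ) : (G →₀ ℂ) →ₗ[ℂ] (G →₀ ℂ) :=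
  Finsupp.lsum ℂ fun g => (α g : ℂ) • Finsupp.lsingle g

/-- Two Frobenius structures are equivalent if some rescaling `e_g ↦ α(g)·e_g` is an
isomorphism of Frobenius algebras between them (such a rescaling is automatically a
linear isomorphism). -/
def frobEquiv (F F' : SepFrobStruct G) : Prop :=
  ∃ α : G → ℂˣ,
    (∀ x y : G →₀ ℂ, rescale α (F.1.mul x y) = F'.1.mul (rescale α x) (rescale α y)) ∧
    (rescale α ∘ₗ F.1.unit = F'.1.unit) ∧
    (F'.1.counit ∘ₗ rescale α = F.1.counit) ∧
    (TensorProduct.map (rescale α) (rescale α) ∘ₗ F.1.comul = F'.1.comul ∘ₗ rescale α)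

/-- Normalized 2-cocycles on `G` with values in `ℂˣ` (trivial `G`-action). -/
def NormalizedTwoCocycle (G : Type*) [Group G] : Type _ :=
  {c : G → G → ℂˣ // (∀ g h k : G, c g (h * k) * c h k = c g h * c (g * h) k) ∧
    ∀ g : G, c g 1 = 1 ∧ c 1 g = 1}

/-- Cohomologous normalized 2-cocycles: `c` and `c'` differ by the coboundary of some
`α : G → ℂˣ`.  The quotient of normalized 2-cocycles by this relation is `H²(G,ℂˣ)`
(every class of a 2-cocycle contains a normalized representative). -/
def cohomologous (c c' : NormalizedTwoCocycle G) : Prop :=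
  ∃ α : G → ℂˣ, ∀ g h : G, c.1 g h = α g * α h * (α (g * h))⁻¹ * c'.1 g h

variable (G) in
/-- The assignment sending a normalized 2-cocycle `c` to the Frobenius data
`μ(e_g ⊗ e_h) = c(g,h)·e_{gh}`, `η(1) = e_e`,
`Δ(e_k) = |G|⁻¹ Σ_{gh=k} c(g,h)⁻¹ e_g ⊗ e_h`, `ε(e_g) = |G|·δ_{g,e}`. -/
noncomputable def frobOfCocycle [Fintype G] [DecidableEq G] (c : G → G → ℂˣ) :
    FrobeniusData G where
  mul := Finsupp.lsum ℂ fun g => (LinearMap.id : ℂ →ₗ[ℂ] ℂ).smulRight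
    (Finsupp.lsum ℂ fun h => (c g h : ℂ) • Finsupp.lsingle (g * h))
  unit := Finsupp.lsingle 1
  comul := Finsupp.lsum ℂ fun k => (LinearMap.id : ℂ →ₗ[ℂ] ℂ).smulRight
    ((Fintype.card G : ℂ)⁻¹ •
      ∑ p ∈ Finset.univ.filter (fun p : G × G => p.1 * p.2 = k),
        ((c p.1 p.2 : ℂ))⁻¹ • (Finsupp.single p.1 (1 : ℂ) ⊗ₜ[ℂ] Finsupp.single p.2 (1 : ℂ)))
  counit := (Fintype.card G : ℂ) • Finsupp.lapply 1

lemma NormalizedTwoCocycle.cocycle_coe (c : NormalizedTwoCocycle G) (g h k : G) :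
    (c.1 g (h * k) : ℂ) * c.1 h k = c.1 g h * c.1 (g * h) k := by
  exact_mod_cast congrArg Units.val (c.2.1 g h k)

lemma FrobeniusData.eq_of_basis {F F' : FrobeniusData G}
    (hmul : ∀ g h, F.mul (single g 1) (single h 1) = F'.mul (single g 1) (single h 1))
    (hunit : F.unit 1 = F'.unit 1)
    (hcomul : ∀ k, F.comul (single k 1) = F'.comul (single k 1))
    (hcounit : ∀ g, F.counit (single g 1) = F'.counit (single g 1)) : F = F' := by
  obtain ⟨m, u, d, e⟩ := F
  obtain ⟨m', u', d', e'⟩ := F'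
  rw [FrobeniusData.mk.injEq]
  refine ⟨?_, ?_, ?_, ?_⟩
  · ext1 g; ext1; ext1 h; ext1
    exact hmul g h
  · ext1
    exact hunit
  · ext1 k; ext1
    exact hcomul k
  · ext1 g; ext1
    exact hcounit g

lemma exists_comul_coeff [Fintype G] {k : G} {v : (G →₀ ℂ) ⊗[ℂ] (G →₀ ℂ)}
    (hv : v ∈ Submodule.span ℂ {v : TensorProduct ℂ (G →₀ ℂ) (G →₀ ℂ) |
      ∃ g h : G, g * h = k ∧ v = single g (1 : ℂ) ⊗ₜ[ℂ] single h (1 : ℂ)}) :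
    ∃ d : G → ℂ, v = ∑ a, d a • (single a (1 : ℂ) ⊗ₜ[ℂ] single (a⁻¹ * k) (1 : ℂ)) := by
  have hset : {v : TensorProduct ℂ (G →₀ ℂ) (G →₀ ℂ) |
      ∃ g h : G, g * h = k ∧ v = single g (1 : ℂ) ⊗ₜ[ℂ] single h (1 : ℂ)} =
      Set.range fun a => single a (1 : ℂ) ⊗ₜ[ℂ] single (a⁻¹ * k) (1 : ℂ) := by
    ext v
    constructor
    · rintro ⟨g, h, rfl, rfl⟩
      exact ⟨g, by simp⟩
    · rintro ⟨a, rfl⟩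
      exact ⟨a, a⁻¹ * k, by simp, rfl⟩
  rw [hset] at hv
  obtain ⟨d, hd⟩ := (Submodule.mem_span_range_iff_exists_fun ℂ).mp hv
  exact ⟨d, hd.symm⟩

lemma sum_filter_mul_eq [Fintype G] [DecidableEq G] {M : Type*} [AddCommMonoid M]
    (f : G → G → M) (k : G) :
    ∑ p ∈ Finset.univ.filter (fun p : G × G => p.1 * p.2 = k), f p.1 p.2 =
      ∑ a, f a (a⁻¹ * k) := by
  refine (Finset.sum_bij (fun a _ => (a, a⁻¹ * k)) ?_ ?_ ?_ ?_).symm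
  · simp
  · intro a _ b _ h
    exact congrArg Prod.fst h
  · rintro ⟨a, b⟩ h
    refine ⟨a, Finset.mem_univ _, ?_⟩
    simp only [Finset.mem_filter, Finset.mem_univ, true_and] at h
    simp [← h]
  · simp

@[simp]
lemma rescale_single {X : Type*} (α : X → ℂˣ) (g : X) :
    rescale α (single g 1) = (α g : ℂ) • single g 1 := by
  simp [rescale]

section FrobOfCocycle

variable [Fintype G] [DecidableEq G]

@[simp]
lemma frobOfCocycle_mul_single (c : G → G → ℂˣ) (g h : G) :
    (frobOfCocycle G c).mul (single g 1) (single h 1) = (c g h : ℂ) • single (g * h) 1 := by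
  simp [frobOfCocycle]

@[simp]
lemma frobOfCocycle_unit_one (c : G → G → ℂˣ) :
    (frobOfCocycle G c).unit 1 = single 1 1 := by
  simp [frobOfCocycle]

@[simp]
lemma frobOfCocycle_counit_single (c : G → G → ℂˣ) (g : G) :
    (frobOfCocycle G c).counit (single g 1) = if g = 1 then (Fintype.card G : ℂ) else 0 := by
  simp [frobOfCocycle, Finsupp.single_apply]

@[simp]
lemma frobOfCocycle_comul_single (c : G → G → ℂˣ) (k : G) :
    (frobOfCocycle G c).comul (single k 1) = (Fintype.card G : ℂ)⁻¹ •
      ∑ a, (c a (a⁻¹ * k) : ℂ)⁻¹ • (single a (1 : ℂ) ⊗ₜ[ℂ] single (a⁻¹ * k) (1 : ℂ)) := by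
  simp only [frobOfCocycle, coe_lsum, map_zero, sum_single_index, LinearMap.smulRight_apply,
    LinearMap.id_apply, one_smul]
  rw [sum_filter_mul_eq fun g h =>
    (c g h : ℂ)⁻¹ • (single g (1 : ℂ) ⊗ₜ[ℂ] single h (1 : ℂ))]

lemma frobOfCocycle_isSepFrob (c : NormalizedTwoCocycle G) :
    (frobOfCocycle G c.1).IsSepFrob := by
  have hG : (Fintype.card G : ℂ) ≠ 0 := Nat.cast_ne_zero.mpr Fintype.card_ne_zero
  refine ⟨?_, ?_, ?_, ?_, ?_, ?_, ?_, ?_, ?_, ?_, ?_, ?_, ?_⟩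
  · set F := frobOfCocycle G c.1 with hF
    have key : LinearMap.compr₂ F.mul F.mul =
        (LinearMap.llcomp ℂ _ _ _).flip F.mul ∘ₗ LinearMap.llcomp ℂ _ _ _ ∘ₗ F.mul := by
      ext1 g; ext1; ext1 h; ext1; ext1 k; ext1
      have := c.cocycle_coe g h k
      simp only [LinearMap.comp_apply, LinearMap.compr₂_apply, LinearMap.flip_apply,
        LinearMap.llcomp_apply, lsingle_apply, hF, frobOfCocycle_mul_single, map_smul,
        LinearMap.smul_apply, smul_smul, mul_assoc, this.symm]
      rw [mul_comm]
    intro x y z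
    exact congr($key x y z)
  · have key : (frobOfCocycle G c.1).mul (single 1 1) = LinearMap.id := by
      ext1 g; ext1
      simp [(c.2.2 g).2]
    intro x
    simp [key]
  · have key : (frobOfCocycle G c.1).mul.flip (single 1 1) = LinearMap.id := by
      ext1 g; ext1
      simp [(c.2.2 g).1]
    intro x
    simpa using congr($key x)
  · ext1 k; ext1
    simp only [LinearMap.comp_apply, lsingle_apply, frobOfCocycle_comul_single, map_smul, map_sum,
      map_tmul, LinearMap.id_apply, smul_tmul, tmul_smul, sum_tmul, tmul_sum,
      LinearEquiv.coe_coe, assoc_tmul, Finset.smul_sum]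
    rw [Finset.sum_comm]
    refine Finset.sum_congr rfl fun b _ => ?_
    refine (Equiv.sum_comp (Equiv.mulLeft b) _).symm.trans (Finset.sum_congr rfl fun m _ => ?_)
    have := c.cocycle_coe b m (m⁻¹ * (b⁻¹ * k))
    simp only [Equiv.coe_mulLeft, inv_mul_cancel_left, mul_inv_rev, mul_inv_cancel_left,
      mul_assoc, smul_smul] at this ⊢
    congr 1
    field_simp
    linear_combination this
  · ext1 k; ext1
    simp [ite_tmul, hG, (c.2.2 k).2]
  · ext1 k; ext1
    simp [tmul_ite, hG, (c.2.2 k).1, inv_mul_eq_one]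
  · ext1; ext1 g; ext1; ext1 h; ext1
    simp only [AlgebraTensorModule.curry_apply, LinearMap.restrictScalars_self,
      TensorProduct.curry_apply, LinearMap.comp_apply, lsingle_apply,
      frobOfCocycle_comul_single, frobOfCocycle_mul_single,
      map_smul, map_sum, map_tmul, LinearMap.id_apply, lift.tmul, smul_tmul, tmul_smul, tmul_sum,
      LinearEquiv.coe_coe, assoc_symm_tmul, smul_smul, Finset.smul_sum]
    refine Eq.trans (Finset.sum_congr rfl fun a _ => ?_)
      (Equiv.sum_comp (Equiv.mulLeft g) _)
    have := c.cocycle_coe g a (a⁻¹ * h)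
    simp only [Equiv.coe_mulLeft, mul_inv_rev, mul_assoc, inv_mul_cancel_left,
      mul_inv_cancel_left] at this ⊢
    congr 1
    field_simp
    linear_combination -this
  · ext1; ext1 g; ext1; ext1 h; ext1
    simp only [AlgebraTensorModule.curry_apply, LinearMap.restrictScalars_self,
      TensorProduct.curry_apply, LinearMap.comp_apply, lsingle_apply,
      frobOfCocycle_comul_single, frobOfCocycle_mul_single,
      map_smul, map_sum, map_tmul, LinearMap.id_apply, lift.tmul, smul_tmul, tmul_smul, sum_tmul,
      LinearEquiv.coe_coe, assoc_tmul, smul_smul, Finset.smul_sum]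
    refine Finset.sum_congr rfl fun a _ => ?_
    have := c.cocycle_coe a (a⁻¹ * g) h
    simp only [mul_assoc, mul_inv_cancel_left] at this ⊢
    congr 1
    field_simp
    linear_combination this
  · ext1 k; ext1
    simp [hG]
  · exact fun g h => ⟨c.1 g h, by simp⟩
  · simp
  · intro k
    rw [frobOfCocycle_comul_single]
    refine Submodule.smul_mem _ _ (Submodule.sum_mem _ fun a _ => Submodule.smul_mem _ _ ?_)
    exact Submodule.subset_span ⟨a, a⁻¹ * k, by simp, rfl⟩
  · intro g hg
    simp [hg]

lemma FrobeniusData.IsSepFrob.exists_cocycle {F : FrobeniusData G} (hF : F.IsSepFrob) :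
    ∃ c : NormalizedTwoCocycle G, F = frobOfCocycle G c.1 := by
  have hG : (Fintype.card G : ℂ) ≠ 0 := Nat.cast_ne_zero.mpr Fintype.card_ne_zero
  obtain ⟨hassoc, hone_mul, hmul_one, -, hcounit, -, hfrob, -, hsep, hgr, hunit, hspan, hε⟩ := hF
  choose c hc using hgr
  choose d hd using fun k => exists_comul_coeff (hspan k)
  have hsingle {x : G} {z w : ℂ} (h : z • single x (1 : ℂ) = w • single x 1) : z = w := by
    simpa using congr($h x)
  let C : NormalizedTwoCocycle G := ⟨c, fun g h k => by
    have := hassoc (single g 1) (single h 1) (single k 1)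
    simp only [hc, map_smul, LinearMap.smul_apply, smul_smul, mul_assoc] at this
    ext
    push_cast
    linear_combination -hsingle this, fun g => by
    have h₁ := hmul_one (single g 1)
    have h₂ := hone_mul (single g 1)
    rw [hunit, hc] at h₁ h₂
    constructor <;> ext
    · exact hsingle (x := g) (by simpa using h₁)
    · exact hsingle (x := g) (by simpa using h₂)⟩
  have hd_one (k : G) : d k 1 * F.counit (single 1 1) = 1 := by
    have h := congr($hcounit (single k 1))
    simp only [LinearMap.comp_apply, hd, map_sum, map_smul, map_tmul, LinearMap.id_apply,
      LinearEquiv.coe_coe, lid_tmul] at h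
    rw [Finset.sum_eq_single 1 (by intro a _ ha; simp [hε a ha]) (by simp)] at h
    apply hsingle (x := k)
    simpa [smul_smul] using h
  have hcoeff (g a k : G) : d k a * c g a = c g k * d (g * k) (g * a) := by
    have h := congr($hfrob (single g 1 ⊗ₜ single k 1))
    simp only [LinearMap.comp_apply, hd, hc, map_sum, map_smul, map_tmul, LinearMap.id_apply,
      LinearEquiv.coe_coe, lift.tmul, tmul_sum, tmul_smul, assoc_symm_tmul, smul_tmul] at h
    replace h := congrArg (fun v => TensorProduct.lid ℂ (G →₀ ℂ)
      (TensorProduct.map (lapply (g * a)) LinearMap.id v) (a⁻¹ * k)) h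
    simpa [single_apply, ite_tmul, Finset.sum_apply', apply_ite] using h
  have hd_eq (k a : G) : d k a * F.counit (single 1 1) * c a (a⁻¹ * k) = 1 := by
    have h₁ := hcoeff a⁻¹ a k
    have h₂ := C.cocycle_coe a⁻¹ a (a⁻¹ * k)
    have h₃ := hd_one (a⁻¹ * k)
    have h₄ : (c 1 (a⁻¹ * k) : ℂ) = 1 := by simpa using congrArg Units.val (C.2.2 (a⁻¹ * k)).2
    simp only [C, mul_inv_cancel_left, inv_mul_cancel, h₄] at h₁ h₂
    have hne := (c a⁻¹ a).ne_zero
    apply mul_right_cancel₀ hne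
    linear_combination F.counit (single 1 1) * c a (a⁻¹ * k) * h₁ +
      c a⁻¹ k * c a (a⁻¹ * k) * h₃ + h₂
  have hcard : F.counit (single 1 1) = Fintype.card G := by
    have h := congr($hsep (single 1 1))
    simp only [LinearMap.comp_apply, hd, hc, map_sum, map_smul, lift.tmul, LinearMap.id_apply,
      smul_smul, mul_inv_cancel_left, ← Finset.sum_smul] at h
    have h' : ∑ a, d 1 a * (c a (a⁻¹ * 1) : ℂ) = 1 := hsingle (x := (1 : G)) (by simpa using h)
    calc F.counit (single 1 1)
        = ∑ a, d 1 a * F.counit (single 1 1) * (c a (a⁻¹ * 1) : ℂ) := by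
          simp only [mul_right_comm _ (F.counit _), ← Finset.sum_mul, h', one_mul]
      _ = Fintype.card G := by simp only [hd_eq]; simp
  refine ⟨C, FrobeniusData.eq_of_basis (fun g h => ?_) ?_ (fun k => ?_) fun g => ?_⟩
  · rw [hc, frobOfCocycle_mul_single]
  · rw [hunit, frobOfCocycle_unit_one]
  · rw [hd, frobOfCocycle_comul_single, Finset.smul_sum]
    refine Finset.sum_congr rfl fun a _ => ?_
    have := hd_eq k a
    rw [hcard] at this
    rw [smul_smul]
    congr 1
    simp only [C]
    field_simp
    linear_combination this
  · rw [frobOfCocycle_counit_single]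
    split_ifs with hg
    · rw [hg, hcard]
    · exact hε g hg

lemma frobOfCocycle_injective : Function.Injective (frobOfCocycle G) := by
  intro c c' h
  ext g k
  have := congr(($h).mul (single g 1) (single k 1) (g * k))
  simpa using this

end FrobOfCocycle

lemma frobEquiv_iff_cohomologous [Fintype G] [DecidableEq G] {c c' : NormalizedTwoCocycle G} :
    frobEquiv ⟨frobOfCocycle G c.1, frobOfCocycle_isSepFrob c⟩
      ⟨frobOfCocycle G c'.1, frobOfCocycle_isSepFrob c'⟩ ↔ cohomologous c c' := by
  refine exists_congr fun α => ⟨fun ⟨hmul, _⟩ g h => ?_, fun hα => ?_⟩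
  · have := congr($(hmul (single g 1) (single h 1)) (g * h))
    simp only [frobOfCocycle_mul_single, rescale_single, map_smul, LinearMap.smul_apply,
      Finsupp.smul_apply, single_eq_same, smul_eq_mul, mul_one] at this
    ext
    push_cast
    field_simp
    linear_combination this
  · have hα' (g h : G) : (c.1 g h : ℂ) * α (g * h) = α g * α h * c'.1 g h := by
      rw [hα g h]
      push_cast
      field_simp
    have hα_one : (α 1 : ℂ) = 1 := by
      have := hα' 1 1
      simpa [(c.2.2 1).1, (c'.2.2 1).1] using this
    refine ⟨?_, ?_, ?_, ?_⟩
    · have key : LinearMap.compr₂ (frobOfCocycle G c.1).mul (rescale α) =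
          (frobOfCocycle G c'.1).mul.compl₁₂ (rescale α) (rescale α) := by
        ext1 g; ext1; ext1 h; ext1
        simp only [LinearMap.comp_apply, LinearMap.compr₂_apply, LinearMap.compl₁₂_apply,
          lsingle_apply, frobOfCocycle_mul_single, rescale_single, map_smul,
          LinearMap.smul_apply, smul_smul, hα']
        ring_nf
      intro x y
      exact congr($key x y)
    · ext1
      simp [rescale_single, hα_one, -smul_single]
    · ext1 g; ext1
      by_cases hg : g = 1 <;> simp [rescale_single, hα_one, hg, -smul_single]
    · ext1 k; ext1
      simp only [LinearMap.comp_apply, lsingle_apply, frobOfCocycle_comul_single, rescale_single,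
        map_smul, map_sum, map_tmul, smul_tmul, tmul_smul, smul_smul, Finset.smul_sum]
      refine Finset.sum_congr rfl fun a _ => ?_
      have := hα' a (a⁻¹ * k)
      simp only [mul_inv_cancel_left] at this
      congr 1
      field_simp
      linear_combination -this


/-- the assignment `c ↦ (μ_c, η, Δ_c, ε)` lands in the separable Frobenius
structures compatible with the grading, and induces a well-defined bijection from
`H²(G, ℂˣ)` (the quotient of normalized 2-cocycles by coboundaries) to the set of
equivalence classes of such structures modulo Frobenius isomorphisms of the form
`e_g ↦ α(g)·e_g`. -/
theorem stmt_0 (G : Type*) [Group G] [Fintype G] [DecidableEq G] :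
    (∀ c : NormalizedTwoCocycle G, (frobOfCocycle G c.1).IsSepFrob) ∧
    ∃ Fbar : Quot (cohomologous (G := G)) → Quot (frobEquiv (G := G)),
      Function.Bijective Fbar ∧
      ∀ c : NormalizedTwoCocycle G, ∃ h : (frobOfCocycle G c.1).IsSepFrob,
        Fbar (Quot.mk _ c) = Quot.mk _ (⟨frobOfCocycle G c.1, h⟩ : SepFrobStruct G) := by
  refine ⟨frobOfCocycle_isSepFrob, ?_⟩
  choose cocycle hcocycle using fun F : SepFrobStruct G => F.2.exists_cocycle
  let frob (c : NormalizedTwoCocycle G) : SepFrobStruct G :=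
    ⟨frobOfCocycle G c.1, frobOfCocycle_isSepFrob c⟩
  have hleft (c : NormalizedTwoCocycle G) : cocycle (frob c) = c :=
    Subtype.ext (frobOfCocycle_injective (hcocycle (frob c)).symm)
  have hright (F : SepFrobStruct G) : frob (cocycle F) = F := Subtype.ext (hcocycle F).symm
  refine ⟨Quot.map frob fun _ _ => frobEquiv_iff_cohomologous.mpr,
    Function.bijective_iff_has_inverse.mpr ⟨Quot.map cocycle fun F F' h => ?_, ?_, ?_⟩,
    fun c => ⟨frobOfCocycle_isSepFrob c, rfl⟩⟩
  · rw [← hright F, ← hright F'] at h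
    exact frobEquiv_iff_cohomologous.mp h
  · rintro ⟨c⟩
    exact congrArg (Quot.mk _) (hleft c)
  · rintro ⟨F⟩
    exact congrArg (Quot.mk _) (hright F)
end

section
/- Let C be a monoidal category with unit object 𝟙 that admits reflexive coequalizers, preserved by tensoring on either side with any fixed object. Let X, Y, Z be objects of C equipped with: morphisms ev : X ⊗ Y ⟶ 𝟙 and coev : 𝟙 ⟶ Y ⊗ X satisfying the zigzag identities (ev ⊗ 1_X)∘(1_X ⊗ coev) = 1_X and (1_Y ⊗ ev)∘(coev ⊗ 1_Y) = 1_Y (up to coherence isomorphisms); morphisms ev_l : Z ⊗ X ⟶ 𝟙 and coev_l : 𝟙 ⟶ X ⊗ Z satisfying the analogous zigzag identities; and an isomorphism α : Z ⟶ Y such that the endomorphism tr_r(α) := ev ∘ (1_X ⊗ α) ∘ coev_l of 𝟙 is invertible. Let A := Y ⊗ X be the monoid in C with multiplication 1_Y ⊗ ev ⊗ 1_X : (Y ⊗ X) ⊗ (Y ⊗ X) ⟶ Y ⊗ X and unit coev. Regard X as a right A-module via ev ⊗ 1_X : X ⊗ (Y ⊗ X) ⟶ X and Y as a left A-module via 1_Y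 ⊗ ev : (Y ⊗ X) ⊗ Y ⟶ Y. Then the morphism ev : X ⊗ Y ⟶ 𝟙 coequalizes the two morphisms X ⊗ A ⊗ Y ⇉ X ⊗ Y given by the right action on X and the left action on Y, and the induced morphism X ⊗_A Y ⟶ 𝟙 from the relative tensor product (the coequalizer of this pair) is an isomorphism. -/
open CategoryTheory MonoidalCategory Limits

/-- For a pairing `ev : X ⊗ Y ⟶ 𝟙_ C`, contracting the first `X ⊗ Y` factor and contracting the
second one agree after composing with `ev`. -/
theorem contract_comp_ev {C : Type*} [Category C] [MonoidalCategory C]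
    {X Y : C} (ev : X ⊗ Y ⟶ 𝟙_ C) :
    (((α_ X Y X).inv ≫ (ev ▷ X) ≫ (λ_ X).hom) ▷ Y) ≫ ev =
      ((α_ X (Y ⊗ X) Y).hom ≫ (X ◁ ((α_ Y X Y).hom ≫ (Y ◁ ev) ≫ (ρ_ Y).hom))) ≫ ev := by
  calc
    _ = ((α_ X Y X).inv ▷ Y ≫ (α_ (X ⊗ Y) X Y).hom) ≫ (ev ▷ (X ⊗ Y) ≫ 𝟙_ C ◁ ev) ≫
        (λ_ (𝟙_ C)).hom := by
      simp
    _ = ((α_ X Y X).inv ▷ Y ≫ (α_ (X ⊗ Y) X Y).hom) ≫ ((X ⊗ Y) ◁ ev ≫ ev ▷ 𝟙_ C) ≫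
        (λ_ (𝟙_ C)).hom := by
      rw [whisker_exchange]
    _ = _ := by
      simp [unitors_equal]

/-- A pairing `ev : X ⊗ Y ⟶ 𝟙_ C` with a section is a split coequalizer of the two contractions
`X ⊗ (Y ⊗ X) ⊗ Y ⇉ X ⊗ Y`. -/
def isSplitCoequalizerOfSection {C : Type*} [Category C] [MonoidalCategory C]
    {X Y : C} (ev : X ⊗ Y ⟶ 𝟙_ C) (s : 𝟙_ C ⟶ X ⊗ Y) (hs : s ≫ ev = 𝟙 (𝟙_ C)) :
    IsSplitCoequalizer (((α_ X Y X).inv ≫ (ev ▷ X) ≫ (λ_ X).hom) ▷ Y)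
      ((α_ X (Y ⊗ X) Y).hom ≫ (X ◁ ((α_ Y X Y).hom ≫ (Y ◁ ev) ≫ (ρ_ Y).hom))) ev where
  rightSection := s
  leftSection := (ρ_ (X ⊗ Y)).inv ≫ (X ⊗ Y) ◁ s ≫ (α_ (X ⊗ Y) X Y).inv ≫ (α_ X Y X).hom ▷ Y
  condition := contract_comp_ev ev
  rightSection_π := hs
  leftSection_bottom := by
    have h : (X ⊗ Y) ◁ s ≫ (X ⊗ Y) ◁ ev = 𝟙 _ := by
      rw [← whiskerLeft_comp, hs, whiskerLeft_id]
    calc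
      _ = (ρ_ (X ⊗ Y)).inv ≫ ((X ⊗ Y) ◁ s ≫ (X ⊗ Y) ◁ ev) ≫ (ρ_ (X ⊗ Y)).hom := by
        simp
      _ = 𝟙 _ := by
        rw [h]; simp
  leftSection_top := by
    calc
      _ = (ρ_ (X ⊗ Y)).inv ≫ ((X ⊗ Y) ◁ s ≫ ev ▷ (X ⊗ Y)) ≫ (λ_ (X ⊗ Y)).hom := by
        simp
      _ = (ρ_ (X ⊗ Y)).inv ≫ (ev ▷ 𝟙_ C ≫ 𝟙_ C ◁ s) ≫ (λ_ (X ⊗ Y)).hom := by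
        rw [whisker_exchange]
      _ = ev ≫ s := by
        simp [unitors_equal]

/-- Let `C` be a monoidal category with reflexive coequalizers, preserved
by tensoring on either side. Given dualities `(ev, coev)` and `(ev_l, coev_l)`
exhibiting `Y` as a right dual and `Z` as a left dual of `X` (zigzag identities up to
coherence isomorphisms), and an isomorphism `α : Z ≅ Y` whose trace
`tr_r(α) = ev ∘ (1 ⊗ α) ∘ coev_l : 𝟙 ⟶ 𝟙` is invertible, consider the monoid
`A = Y ⊗ X` (multiplication `1_Y ⊗ ev ⊗ 1_X`, unit `coev`), `X` as a right `A`-module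
via `ev ⊗ 1_X` and `Y` as a left `A`-module via `1_Y ⊗ ev`. Then `ev : X ⊗ Y ⟶ 𝟙`
coequalizes the two action morphisms `X ⊗ A ⊗ Y ⇉ X ⊗ Y`, and the induced morphism
`X ⊗_A Y ⟶ 𝟙` from the relative tensor product (any coequalizer of this pair) is an
isomorphism. -/
theorem stmt_3 {C : Type*} [Category C] [MonoidalCategory C]
    [HasReflexiveCoequalizers C]
    (hpresL : ∀ (W A B : C) (f g : A ⟶ B), IsReflexivePair f g →
      Nonempty (PreservesColimit (parallelPair f g) (tensorLeft W)))
    (hpresR : ∀ (W A B : C) (f g : A ⟶ B), IsReflexivePair f g →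
      Nonempty (PreservesColimit (parallelPair f g) (tensorRight W)))
    (X Y Z : C)
    (ev : X ⊗ Y ⟶ 𝟙_ C) (coev : 𝟙_ C ⟶ Y ⊗ X)
    (zig₁ : (ρ_ X).inv ≫ (X ◁ coev) ≫ (α_ X Y X).inv ≫ (ev ▷ X) ≫ (λ_ X).hom = 𝟙 X)
    (zig₂ : (λ_ Y).inv ≫ (coev ▷ Y) ≫ (α_ Y X Y).hom ≫ (Y ◁ ev) ≫ (ρ_ Y).hom = 𝟙 Y)
    (evl : Z ⊗ X ⟶ 𝟙_ C) (coevl : 𝟙_ C ⟶ X ⊗ Z)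
    (zig₃ : (λ_ X).inv ≫ (coevl ▷ X) ≫ (α_ X Z X).hom ≫ (X ◁ evl) ≫ (ρ_ X).hom = 𝟙 X)
    (zig₄ : (ρ_ Z).inv ≫ (Z ◁ coevl) ≫ (α_ Z X Z).inv ≫ (evl ▷ Z) ≫ (λ_ Z).hom = 𝟙 Z)
    (α : Z ≅ Y)
    (trα : 𝟙_ C ⟶ 𝟙_ C) (htr : trα = coevl ≫ (X ◁ α.hom) ≫ ev) [IsIso trα]
    -- the two morphisms `X ⊗ A ⊗ Y ⇉ X ⊗ Y` given by the right action on `X`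
    -- and the left action on `Y`, where `A = Y ⊗ X`
    (f g : (X ⊗ (Y ⊗ X)) ⊗ Y ⟶ X ⊗ Y)
    (hf : f = ((α_ X Y X).inv ≫ (ev ▷ X) ≫ (λ_ X).hom) ▷ Y)
    (hg : g = (α_ X (Y ⊗ X) Y).hom ≫ (X ◁ ((α_ Y X Y).hom ≫ (Y ◁ ev) ≫ (ρ_ Y).hom))) :
    ∃ w : f ≫ ev = g ≫ ev,
      ∀ (cf : Cofork f g) (hc : IsColimit cf), IsIso (hc.desc (Cofork.ofπ ev w)) := by
  subst hf hg
  have hs : (inv trα ≫ coevl ≫ X ◁ α.hom) ≫ ev = 𝟙 (𝟙_ C) := by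
    simp only [Category.assoc, ← htr, IsIso.inv_hom_id]
  let t := isSplitCoequalizerOfSection ev _ hs
  exact ⟨t.condition, fun cf hc => (hc.coconePointUniqueUpToIso t.isCoequalizer).isIso_hom⟩
end

section
/- Let G be a finite group and c a normalized 2-cocycle on G with values in ℂˣ. On the twisted group algebra A = ℂ_c[G] define the linear maps Δ : A → A ⊗ A by Δ(e_k) = |G|⁻¹ Σ_{(g,h) ∈ G×G, gh = k} c(g,h)⁻¹ e_g ⊗ e_h, and ε : A → ℂ by ε(e_g) = |G|·δ_{g,e}. Then, writing μ : A ⊗ A → A for the multiplication: (1) Δ is coassociative, i.e. (Δ ⊗ id)∘Δ = (id ⊗ Δ)∘Δ; (2) ε is a counit for Δ, i.e. (ε ⊗ id)∘Δ = id_A = (id ⊗ ε)∘Δ; (3) the Frobenius law holds: (μ ⊗ id)∘(id ⊗ Δ) = Δ∘μ = (id ⊗ μ)∘(Δ ⊗ id) as maps A ⊗ A → A ⊗ A; and (4) separability holds: μ∘Δ = id_A. -/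
/-- A sum over the factorisations `gh = k` in a finite group, indexed by the left factor. -/
theorem sum_filter_mul_eq_left {G M : Type*} [Group G] [Fintype G] [DecidableEq G]
    [AddCommMonoid M] (f : G → G → M) (k : G) :
    ∑ p ∈ Finset.univ.filter (fun p : G × G => p.1 * p.2 = k), f p.1 p.2
      = ∑ g, f g (g⁻¹ * k) := by
  refine Finset.sum_bij' (fun p _ => p.1) (fun g _ => (g, g⁻¹ * k)) ?_ ?_ ?_ ?_ ?_ <;>
    simp +contextual [eq_comm]

/-- A sum over the factorisations `gh = k` in a finite group, indexed by the right factor. -/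
theorem sum_filter_mul_eq_right {G M : Type*} [Group G] [Fintype G] [DecidableEq G]
    [AddCommMonoid M] (f : G → G → M) (k : G) :
    ∑ p ∈ Finset.univ.filter (fun p : G × G => p.1 * p.2 = k), f p.1 p.2
      = ∑ h, f (k * h⁻¹) h := by
  refine Finset.sum_bij' (fun p _ => p.2) (fun h _ => (k * h⁻¹, h)) ?_ ?_ ?_ ?_ ?_ <;>
    simp +contextual [eq_comm]

/-- On the twisted group algebra `ℂ_c[G]` (with multiplication `μ`
determined by `e_g · e_h = c(g,h) e_{gh}`), the maps
`Δ(e_k) = |G|⁻¹ Σ_{gh=k} c(g,h)⁻¹ e_g ⊗ e_h` and `ε(e_g) = |G|·δ_{g,e}` make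
`(μ, Δ, ε)` a separable Frobenius structure: `Δ` is coassociative with counit `ε`,
the Frobenius law holds, and `μ ∘ Δ = id`. -/
theorem stmt_7 {G : Type*} [Group G] [Fintype G] [DecidableEq G]
    (c : G → G → ℂˣ)
    (hcoc : ∀ g h k : G, c g (h * k) * c h k = c g h * c (g * h) k)
    (hnorm : ∀ g : G, c g 1 = 1 ∧ c 1 g = 1)
    (μ : (G →₀ ℂ) →ₗ[ℂ] (G →₀ ℂ) →ₗ[ℂ] (G →₀ ℂ))
    (hμ : ∀ (g h : G) (a b : ℂ),
      μ (Finsupp.single g a) (Finsupp.single h b)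
        = (c g h : ℂ) • Finsupp.single (g * h) (a * b))
    (Δ : (G →₀ ℂ) →ₗ[ℂ] TensorProduct ℂ (G →₀ ℂ) (G →₀ ℂ))
    (hΔ : ∀ k : G, Δ (Finsupp.single k 1) = (Fintype.card G : ℂ)⁻¹ •
      ∑ p ∈ Finset.univ.filter (fun p : G × G => p.1 * p.2 = k),
        ((c p.1 p.2 : ℂ))⁻¹ • (Finsupp.single p.1 (1 : ℂ) ⊗ₜ[ℂ] Finsupp.single p.2 (1 : ℂ)))
    (ε : (G →₀ ℂ) →ₗ[ℂ] ℂ)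
    (hε : ∀ g : G, ε (Finsupp.single g 1) = if g = 1 then (Fintype.card G : ℂ) else 0) :
    -- (1) coassociativity
    ((TensorProduct.assoc ℂ (G →₀ ℂ) (G →₀ ℂ) (G →₀ ℂ)).toLinearMap
        ∘ₗ TensorProduct.map Δ LinearMap.id ∘ₗ Δ
      = TensorProduct.map LinearMap.id Δ ∘ₗ Δ) ∧
    -- (2) counitality
    ((TensorProduct.lid ℂ (G →₀ ℂ)).toLinearMap ∘ₗ TensorProduct.map ε LinearMap.id ∘ₗ Δ
      = LinearMap.id) ∧
    ((TensorProduct.rid ℂ (G →₀ ℂ)).toLinearMap ∘ₗ TensorProduct.map LinearMap.id ε ∘ₗ Δ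
      = LinearMap.id) ∧
    -- (3) the Frobenius law
    (TensorProduct.map (TensorProduct.lift μ) LinearMap.id
        ∘ₗ (TensorProduct.assoc ℂ (G →₀ ℂ) (G →₀ ℂ) (G →₀ ℂ)).symm.toLinearMap
        ∘ₗ TensorProduct.map LinearMap.id Δ
      = Δ ∘ₗ TensorProduct.lift μ) ∧
    (TensorProduct.map LinearMap.id (TensorProduct.lift μ)
        ∘ₗ (TensorProduct.assoc ℂ (G →₀ ℂ) (G →₀ ℂ) (G →₀ ℂ)).toLinearMap
        ∘ₗ TensorProduct.map Δ LinearMap.id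
      = Δ ∘ₗ TensorProduct.lift μ) ∧
    -- (4) separability
    (TensorProduct.lift μ ∘ₗ Δ = LinearMap.id) := by
  have hn : (Fintype.card G : ℂ) ≠ 0 := Nat.cast_ne_zero.mpr Fintype.card_ne_zero
  have hc (g h : G) : (c g h : ℂ) ≠ 0 := (c g h).ne_zero
  have hcoc' (g h k : G) : (c g (h * k) : ℂ) * c h k = c g h * c (g * h) k :=
    mod_cast congrArg Units.val (hcoc g h k)
  have hμ_basis (g h : G) : μ (Finsupp.single g 1) (Finsupp.single h 1)
      = (c g h : ℂ) • Finsupp.single (g * h) (1 : ℂ) := by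
    rw [hμ, mul_one]
  have hΔ_left (k : G) : Δ (Finsupp.single k 1) = (Fintype.card G : ℂ)⁻¹ •
      ∑ g, (c g (g⁻¹ * k) : ℂ)⁻¹ •
        (Finsupp.single g (1 : ℂ) ⊗ₜ[ℂ] Finsupp.single (g⁻¹ * k) (1 : ℂ)) := by
    rw [hΔ, ← sum_filter_mul_eq_left (fun g h => (c g h : ℂ)⁻¹ •
      (Finsupp.single g (1 : ℂ) ⊗ₜ[ℂ] Finsupp.single h (1 : ℂ)))]
  have hΔ_right (k : G) : Δ (Finsupp.single k 1) = (Fintype.card G : ℂ)⁻¹ •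
      ∑ h, (c (k * h⁻¹) h : ℂ)⁻¹ •
        (Finsupp.single (k * h⁻¹) (1 : ℂ) ⊗ₜ[ℂ] Finsupp.single h (1 : ℂ)) := by
    rw [hΔ, ← sum_filter_mul_eq_right (fun g h => (c g h : ℂ)⁻¹ •
      (Finsupp.single g (1 : ℂ) ⊗ₜ[ℂ] Finsupp.single h (1 : ℂ)))]
  refine ⟨?_, ?_, ?_, ?_, ?_, ?_⟩
  · refine Finsupp.lhom_ext' fun k => LinearMap.ext_ring ?_
    simp only [LinearMap.comp_apply, Finsupp.lsingle_apply, LinearEquiv.coe_coe]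
    conv_lhs => rw [hΔ_right]
    conv_rhs => rw [hΔ_left]
    simp only [map_smul, map_sum, TensorProduct.map_tmul, LinearMap.id_apply]
    congr 1
    simp only [hΔ_left (k * _), hΔ_right (_ * k), ← TensorProduct.smul_tmul',
      TensorProduct.tmul_smul, TensorProduct.sum_tmul, TensorProduct.tmul_sum, map_smul, map_sum,
      TensorProduct.assoc_tmul, Finset.smul_sum, smul_smul]
    rw [Finset.sum_comm]
    refine Finset.sum_congr rfl fun g _ => Finset.sum_congr rfl fun h _ => ?_
    rw [mul_assoc g⁻¹ k]
    congr 1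
    have cocycle := hcoc' g (g⁻¹ * k * h⁻¹) h
    rw [inv_mul_cancel_right, mul_assoc g⁻¹, mul_inv_cancel_left] at cocycle
    field_simp [hc]
    linear_combination cocycle
  · refine Finsupp.lhom_ext' fun k => LinearMap.ext_ring ?_
    simp only [LinearMap.comp_apply, Finsupp.lsingle_apply, LinearEquiv.coe_coe, hΔ_left,
      map_smul, map_sum, TensorProduct.map_tmul, LinearMap.id_apply, hε, TensorProduct.lid_tmul]
    simp only [ite_smul, zero_smul, smul_ite, smul_zero, Finset.sum_ite_eq',
      Finset.mem_univ, if_true, inv_one, one_mul, (hnorm _).2, Units.val_one, one_smul, smul_smul,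
      inv_mul_cancel₀ hn]
  · refine Finsupp.lhom_ext' fun k => LinearMap.ext_ring ?_
    simp only [LinearMap.comp_apply, Finsupp.lsingle_apply, LinearEquiv.coe_coe, hΔ_right,
      map_smul, map_sum, TensorProduct.map_tmul, LinearMap.id_apply, hε, TensorProduct.rid_tmul]
    simp only [ite_smul, zero_smul, smul_ite, smul_zero, Finset.sum_ite_eq',
      Finset.mem_univ, if_true, inv_one, mul_one, one_mul, (hnorm _).1, Units.val_one, one_smul,
      smul_smul, inv_mul_cancel₀ hn]
  · refine TensorProduct.ext (Finsupp.lhom_ext' fun a => LinearMap.ext_ring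
      (Finsupp.lhom_ext' fun b => LinearMap.ext_ring ?_))
    simp only [LinearMap.compr₂ₛₗ_apply, TensorProduct.mk_apply, LinearMap.comp_apply,
      Finsupp.lsingle_apply, LinearEquiv.coe_coe, TensorProduct.map_tmul, LinearMap.id_apply,
      TensorProduct.lift.tmul, hμ_basis, map_smul, hΔ_right, TensorProduct.tmul_smul,
      TensorProduct.tmul_sum, map_sum, TensorProduct.assoc_symm_tmul]
    rw [smul_comm]
    congr 1
    rw [Finset.smul_sum]
    refine Finset.sum_congr rfl fun h _ => ?_
    have cocycle := hcoc' a (b * h⁻¹) h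
    rw [inv_mul_cancel_right, ← mul_assoc a] at cocycle
    rw [← TensorProduct.smul_tmul', smul_smul, smul_smul, ← mul_assoc a]
    congr 1
    field_simp [hc]
    linear_combination -cocycle
  · refine TensorProduct.ext (Finsupp.lhom_ext' fun a => LinearMap.ext_ring
      (Finsupp.lhom_ext' fun b => LinearMap.ext_ring ?_))
    simp only [LinearMap.compr₂ₛₗ_apply, TensorProduct.mk_apply, LinearMap.comp_apply,
      Finsupp.lsingle_apply, LinearEquiv.coe_coe, TensorProduct.map_tmul, LinearMap.id_apply,
      TensorProduct.lift.tmul, hμ_basis, map_smul, hΔ_left, ← TensorProduct.smul_tmul',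
      TensorProduct.sum_tmul, map_sum, TensorProduct.assoc_tmul, TensorProduct.tmul_smul]
    rw [smul_comm]
    congr 1
    rw [Finset.smul_sum]
    refine Finset.sum_congr rfl fun g _ => ?_
    have cocycle := hcoc' g (g⁻¹ * a) b
    rw [mul_inv_cancel_left, mul_assoc g⁻¹] at cocycle
    rw [smul_smul, smul_smul, mul_assoc g⁻¹]
    congr 1
    field_simp [hc]
    linear_combination cocycle
  · refine Finsupp.lhom_ext' fun k => LinearMap.ext_ring ?_
    simp only [LinearMap.comp_apply, Finsupp.lsingle_apply, hΔ_left, map_smul, map_sum,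
      TensorProduct.lift.tmul, hμ_basis, smul_smul, inv_mul_cancel₀ (hc _ _),
      mul_inv_cancel_left, one_smul, LinearMap.id_apply, Finset.sum_const, Finset.card_univ]
    rw [← Nat.cast_smul_eq_nsmul ℂ, smul_smul, inv_mul_cancel₀ hn, one_smul]
end

section
/- Let G be an abelian group and c a normalized 2-cocycle on G with values in ℂˣ. Then for all g, h ∈ G the discrete torsion phase ε(g,h) := c(g, hg⁻¹)·c(h, g⁻¹)·c(g, g⁻¹)⁻¹ equals c(g,h)/c(h,g). -/
/-- For a normalized 2-cocycle `c` on an abelian group `G`, the discrete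
torsion phase `ε(g,h) = c(g, hg⁻¹)·c(h, g⁻¹)·c(g, g⁻¹)⁻¹` equals `c(g,h)/c(h,g)`. -/
theorem stmt_10 {G : Type*} [CommGroup G] (c : G → G → ℂˣ)
    (hcoc : ∀ g h k : G, c g (h * k) * c h k = c g h * c (g * h) k)
    (hnorm : ∀ g : G, c g 1 = 1 ∧ c 1 g = 1) :
    ∀ g h : G, c g (h * g⁻¹) * c h g⁻¹ * (c g g⁻¹)⁻¹ = c g h * (c h g)⁻¹ := by
  intro g h
  have h₁ := hcoc h g g⁻¹
  rw [mul_inv_cancel, (hnorm h).1, one_mul, mul_comm h g] at h₁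
  rw [hcoc g h g⁻¹, h₁, mul_inv_rev, mul_assoc, mul_inv_cancel_left]
end
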